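/- In Mat_P(ℂ) the identity q²·R·F0 − F0·R + (q^{k/2}·K1 + q^{(n−k)/2}·K2 − (q+1)·I)·R = 0 holds. -/

import Mathlib

open scoped Classical

noncomputable section

variable {F V : Type} [Field F] [AddCommGroup V] [Module F V]

/-- `v` covers `u` in the projective geometry `P`. -/
def Covers (u v : Submodule F V) : Prop :=
  u ≤ v ∧ Module.finrank F ↥v = Module.finrank F ↥u + 1

/-- `v` slash-covers `u` (relative to the fixed subspace `y`). -/
def SlashCovers (y u v : Submodule F V) : Prop :=
  Covers u v ∧ Module.finrank F ↥(v ⊓ y) = Module.finrank F ↥(u ⊓ y) + 1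

/-- `v` backslash-covers `u` (relative to the fixed subspace `y`). -/
def BackslashCovers (y u v : Submodule F V) : Prop :=
  Covers u v ∧ Module.finrank F ↥(v ⊓ y) = Module.finrank F ↥(u ⊓ y)

/-- `q` raised to a real exponent, as a complex number. -/
def qpow (q : ℕ) (e : ℝ) : ℂ := (((q : ℝ) ^ e : ℝ) : ℂ)

/-- The Gaussian bracket `[m] = (q^m - 1)/(q - 1)` as a rational number. -/
def gaussQ (q m : ℕ) : ℚ := ((q : ℚ) ^ m - 1) / ((q : ℚ) - 1)

/-- The Gaussian bracket `[m] = (q^m - 1)/(q - 1)` as a complex number. -/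
def gaussC (q m : ℕ) : ℂ := ((q : ℂ) ^ m - 1) / ((q : ℂ) - 1)

/-- The diagonal matrix `K1`; the `(u,u)` entry is `q^(k/2 - i)` for `u ∈ P_{i,j}`. -/
def matK1 (q k : ℕ) (y : Submodule F V) : Matrix (Submodule F V) (Submodule F V) ℂ :=
  Matrix.diagonal fun u => qpow q ((k : ℝ) / 2 - (Module.finrank F ↥(u ⊓ y) : ℝ))

/-- The diagonal matrix `K2`; the `(u,u)` entry is `q^(j - (n-k)/2)` for `u ∈ P_{i,j}`. -/
def matK2 (q n k : ℕ) (y : Submodule F V) : Matrix (Submodule F V) (Submodule F V) ℂ :=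
  Matrix.diagonal fun u =>
    qpow q (((Module.finrank F ↥u : ℝ) - (Module.finrank F ↥(u ⊓ y) : ℝ))
      - ((n : ℝ) - (k : ℝ)) / 2)

/-- The 0-1 matrix `L1`; the `(u,v)` entry is `1` iff `v` slash-covers `u`. -/
def matL1 (y : Submodule F V) : Matrix (Submodule F V) (Submodule F V) ℂ :=
  Matrix.of fun u v => if SlashCovers y u v then (1 : ℂ) else 0

/-- The 0-1 matrix `L2`; the `(u,v)` entry is `1` iff `v` backslash-covers `u`. -/
def matL2 (y : Submodule F V) : Matrix (Submodule F V) (Submodule F V) ℂ :=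
  Matrix.of fun u v => if BackslashCovers y u v then (1 : ℂ) else 0

/-- `R1 = L1ᵀ`. -/
def matR1 (y : Submodule F V) : Matrix (Submodule F V) (Submodule F V) ℂ := Matrix.transpose (matL1 y)

/-- `R2 = L2ᵀ`. -/
def matR2 (y : Submodule F V) : Matrix (Submodule F V) (Submodule F V) ℂ := Matrix.transpose (matL2 y)

/-- `R = L1 · R2`. -/
def matR [Fintype (Submodule F V)] (y : Submodule F V) :
    Matrix (Submodule F V) (Submodule F V) ℂ := matL1 y * matR2 y

/-- `L = R1 · L2`. -/
def matL [Fintype (Submodule F V)] (y : Submodule F V) :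
    Matrix (Submodule F V) (Submodule F V) ℂ := matR1 y * matL2 y

/-- The 0-1 matrix `F0`. -/
def matF0 (y : Submodule F V) : Matrix (Submodule F V) (Submodule F V) ℂ :=
  Matrix.of fun u v =>
    if SlashCovers y u (u ⊔ v) ∧ SlashCovers y v (u ⊔ v) ∧
        BackslashCovers y (u ⊓ v) u ∧ BackslashCovers y (u ⊓ v) v then (1 : ℂ) else 0

/-- The 0-1 matrix `F+`. -/
def matFp (y : Submodule F V) : Matrix (Submodule F V) (Submodule F V) ℂ :=
  Matrix.of fun u v =>
    if BackslashCovers y u (u ⊔ v) ∧ BackslashCovers y v (u ⊔ v) then (1 : ℂ) else 0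

/-- The 0-1 matrix `F-`. -/
def matFm (y : Submodule F V) : Matrix (Submodule F V) (Submodule F V) ℂ :=
  Matrix.of fun u v =>
    if SlashCovers y (u ⊓ v) u ∧ SlashCovers y (u ⊓ v) v then (1 : ℂ) else 0

/-- The vertex set `X` of the Grassmann graph: `k`-dimensional subspaces of `V`. -/
abbrev GrassVertex (F V : Type) [Field F] [AddCommGroup V] [Module F V] (k : ℕ) :=
  {z : Submodule F V // Module.finrank F ↥z = k}

/-- The Grassmann graph `J_q(n,k)`: vertices are adjacent iff their intersection
has dimension `k - 1`. -/
def Grass (F V : Type) [Field F] [AddCommGroup V] [Module F V] (k : ℕ) :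
    SimpleGraph (GrassVertex F V k) :=
  SimpleGraph.fromRel fun a b => Module.finrank F ↥(a.1 ⊓ b.1) = k - 1

/-- `B_xy = {z ∈ Γ(x) : ∂(z,y) = ∂(x,y) + 1}`. -/
def Bset {k : ℕ} (x y : GrassVertex F V k) : Set (GrassVertex F V k) :=
  {z | (Grass F V k).Adj x z ∧ (Grass F V k).dist z y = (Grass F V k).dist x y + 1}

/-- `C_xy = {z ∈ Γ(x) : ∂(z,y) = ∂(x,y) - 1}`. -/
def Cset {k : ℕ} (x y : GrassVertex F V k) : Set (GrassVertex F V k) :=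
  {z | (Grass F V k).Adj x z ∧ (Grass F V k).dist z y = (Grass F V k).dist x y - 1}

/-- `A_xy = {z ∈ Γ(x) : ∂(z,y) = ∂(x,y)}`. -/
def Aset {k : ℕ} (x y : GrassVertex F V k) : Set (GrassVertex F V k) :=
  {z | (Grass F V k).Adj x z ∧ (Grass F V k).dist z y = (Grass F V k).dist x y}

/-- `A0_xy`. -/
def A0set {k : ℕ} (x y : GrassVertex F V k) : Set (GrassVertex F V k) :=
  {z | (Grass F V k).Adj x z ∧
    SlashCovers y.1 z.1 (z.1 ⊔ x.1) ∧ SlashCovers y.1 x.1 (z.1 ⊔ x.1) ∧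
    BackslashCovers y.1 (z.1 ⊓ x.1) z.1 ∧ BackslashCovers y.1 (z.1 ⊓ x.1) x.1}

/-- `A+_xy`. -/
def Apset {k : ℕ} (x y : GrassVertex F V k) : Set (GrassVertex F V k) :=
  {z | (Grass F V k).Adj x z ∧
    BackslashCovers y.1 z.1 (z.1 ⊔ x.1) ∧ BackslashCovers y.1 x.1 (z.1 ⊔ x.1)}

/-- `A-_xy`. -/
def Amset {k : ℕ} (x y : GrassVertex F V k) : Set (GrassVertex F V k) :=
  {z | (Grass F V k).Adj x z ∧
    SlashCovers y.1 (z.1 ⊓ x.1) z.1 ∧ SlashCovers y.1 (z.1 ⊓ x.1) x.1}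

/-- The edge `wz` has type `0`. -/
def EdgeType0 {k : ℕ} (y w z : GrassVertex F V k) : Prop :=
  SlashCovers y.1 w.1 (w.1 ⊔ z.1) ∧ SlashCovers y.1 z.1 (w.1 ⊔ z.1) ∧
  BackslashCovers y.1 (w.1 ⊓ z.1) w.1 ∧ BackslashCovers y.1 (w.1 ⊓ z.1) z.1

/-- The edge `wz` has type `+`. -/
def EdgeTypeP {k : ℕ} (y w z : GrassVertex F V k) : Prop :=
  BackslashCovers y.1 w.1 (w.1 ⊔ z.1) ∧ BackslashCovers y.1 z.1 (w.1 ⊔ z.1)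

/-- The edge `wz` has type `-`. -/
def EdgeTypeM {k : ℕ} (y w z : GrassVertex F V k) : Prop :=
  SlashCovers y.1 (w.1 ⊓ z.1) w.1 ∧ SlashCovers y.1 (w.1 ⊓ z.1) z.1


section RankedLattice

variable {α : Type*} [Lattice α]

/-- An integer-valued strictly monotone function on a lattice satisfying the modular identity. -/
structure IsModularRank (d : α → ℤ) : Prop where
  strictMono : StrictMono d
  sup_add_inf : ∀ a b, d (a ⊔ b) + d (a ⊓ b) = d a + d b

/-- `v` covers `u`, and so does `v ⊓ y` over `u ⊓ y`. -/
def RankSlash (d : α → ℤ) (y u v : α) : Prop :=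
  u ≤ v ∧ d v = d u + 1 ∧ d (v ⊓ y) = d (u ⊓ y) + 1

/-- `v` covers `u`, and `v ⊓ y` has the same rank as `u ⊓ y`. -/
def RankBack (d : α → ℤ) (y u v : α) : Prop :=
  u ≤ v ∧ d v = d u + 1 ∧ d (v ⊓ y) = d (u ⊓ y)

/-- The adjacency relation underlying the matrix `F0`. -/
def RankZero (d : α → ℤ) (y u v : α) : Prop :=
  RankSlash d y u (u ⊔ v) ∧ RankSlash d y v (u ⊔ v) ∧
    RankBack d y (u ⊓ v) u ∧ RankBack d y (u ⊓ v) v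

/-- The number of relative complements of an atom or a coatom `p` of an interval `[m, t]` is the
expected power of `q`. -/
def HasComplementCount (d : α → ℤ) (q : ℕ) : Prop :=
  ∀ m p t : α, m ≤ p → p ≤ t → (d p = d m + 1 ∨ d t = d p + 1) →
    {v | v ⊓ p = m ∧ v ⊔ p = t}.ncard = q ^ (d t - d m - 1).toNat

namespace IsModularRank

variable {d : α → ℤ}

lemma eq_of_le (hd : IsModularRank d) {a b : α} (h : a ≤ b) (h' : d b ≤ d a) : a = b := by
  rcases h.lt_or_eq with h | h
  · have := hd.strictMono h
    omega
  · exact h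

lemma inf_sub_le (hd : IsModularRank d) (y : α) {a b : α} (h : a ≤ b) :
    d (b ⊓ y) - d (a ⊓ y) ≤ d b - d a := by
  have h1 := hd.sup_add_inf a (b ⊓ y)
  have h2 : a ⊓ (b ⊓ y) = a ⊓ y := by rw [← inf_assoc, inf_eq_left.2 h]
  have h3 : d (a ⊔ b ⊓ y) ≤ d b := hd.strictMono.monotone (sup_le h inf_le_left)
  rw [h2] at h1
  omega

lemma rankZero_iff (hd : IsModularRank d) {y u v : α} :
    RankZero d y u v ↔ d v = d u ∧ d (u ⊔ v) = d u + 1 ∧ u ⊓ y = v ⊓ y ∧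
      d ((u ⊔ v) ⊓ y) = d (u ⊓ y) + 1 := by
  have hm := hd.sup_add_inf u v
  constructor
  · rintro ⟨⟨-, a, b⟩, ⟨-, c, e⟩, ⟨-, f, g⟩, ⟨-, i, j⟩⟩
    refine ⟨by omega, a, ?_, b⟩
    rw [← hd.eq_of_le (inf_le_inf_right y (inf_le_left : u ⊓ v ≤ u)) (by omega),
      ← hd.eq_of_le (inf_le_inf_right y (inf_le_right : u ⊓ v ≤ v)) (by omega)]
  · rintro ⟨a, b, c, e⟩
    have h : u ⊓ v ⊓ y = u ⊓ y := by
      apply le_antisymm (inf_le_inf_right y inf_le_left)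
      exact le_inf (le_inf inf_le_left (c.le.trans inf_le_left)) inf_le_right
    refine ⟨⟨le_sup_left, b, e⟩, ⟨le_sup_right, by omega, by rw [← c, e]⟩,
      ⟨inf_le_left, by omega, by rw [h]⟩, ⟨inf_le_right, by omega, by rw [h, c]⟩⟩

lemma rankSlash_sup_and_rankBack_sup_iff (hd : IsModularRank d) {y u v : α} :
    RankSlash d y u (u ⊔ v) ∧ RankBack d y v (u ⊔ v) ↔
      RankBack d y (u ⊓ v) u ∧ RankSlash d y (u ⊓ v) v := by
  have hm := hd.sup_add_inf u v
  have key (h : u ⊓ y ≤ v) : u ⊓ v ⊓ y = u ⊓ y :=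
    le_antisymm (inf_le_inf_right y inf_le_left) (le_inf (le_inf inf_le_left h) inf_le_right)
  constructor
  · rintro ⟨⟨-, a, b⟩, ⟨-, c, e⟩⟩
    have h1 := hd.eq_of_le (inf_le_inf_right y (le_sup_right : v ≤ u ⊔ v)) (by omega)
    have h2 := key ((inf_le_inf_right y le_sup_left).trans (h1.ge.trans inf_le_left))
    exact ⟨⟨inf_le_left, by omega, by rw [h2]⟩, ⟨inf_le_right, by omega, by rw [h2]; omega⟩⟩
  · rintro ⟨⟨-, a, b⟩, ⟨-, c, e⟩⟩
    have h1 := hd.inf_sub_le y (le_sup_left : u ≤ u ⊔ v)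
    have h2 := hd.strictMono.monotone (inf_le_inf_right y (le_sup_right : v ≤ u ⊔ v))
    exact ⟨⟨le_sup_left, by omega, by omega⟩, ⟨le_sup_right, by omega, by omega⟩⟩

/-- Common upper covers and common lower covers of mixed type are equinumerous. -/
lemma ncard_rankSlash_rankBack (hd : IsModularRank d) (y u v : α) :
    {w | RankSlash d y u w ∧ RankBack d y v w}.ncard =
      {w | RankBack d y w u ∧ RankSlash d y w v}.ncard := by
  have hm := hd.sup_add_inf u v
  have e1 : {w | RankSlash d y u w ∧ RankBack d y v w} =
      {w | w = u ⊔ v ∧ RankSlash d y u (u ⊔ v) ∧ RankBack d y v (u ⊔ v)} := by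
    ext w
    refine ⟨fun h => ?_, by rintro ⟨rfl, h⟩; exact h⟩
    obtain ⟨⟨a, b, c⟩, ⟨e, f, g⟩⟩ := h
    have hlt : v < u ⊔ v := by
      refine lt_of_le_of_ne le_sup_right fun h => ?_
      have := hd.strictMono.monotone (inf_le_inf_right y a)
      have := hd.eq_of_le (sup_eq_right.1 h.symm) (by omega)
      rw [this] at c; omega
    have := hd.strictMono hlt
    obtain rfl := hd.eq_of_le (sup_le a e) (by omega)
    exact ⟨rfl, ⟨a, b, c⟩, ⟨e, f, g⟩⟩
  have e2 : {w | RankBack d y w u ∧ RankSlash d y w v} =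
      {w | w = u ⊓ v ∧ RankBack d y (u ⊓ v) u ∧ RankSlash d y (u ⊓ v) v} := by
    ext w
    refine ⟨fun h => ?_, by rintro ⟨rfl, h⟩; exact h⟩
    obtain ⟨⟨a, b, c⟩, ⟨e, f, g⟩⟩ := h
    have hlt : u ⊓ v < v := by
      refine lt_of_le_of_ne inf_le_right fun h => ?_
      have := hd.eq_of_le (inf_eq_right.1 h) (by omega)
      rw [this] at g; omega
    have := hd.strictMono hlt
    obtain rfl := hd.eq_of_le (le_inf a e) (by omega)
    exact ⟨rfl, ⟨a, b, c⟩, ⟨e, f, g⟩⟩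
  rw [e1, e2, hd.rankSlash_sup_and_rankBack_sup_iff]
  by_cases h : RankBack d y (u ⊓ v) u ∧ RankSlash d y (u ⊓ v) v <;> simp [h]

lemma sup_inf_eq_of_rankSlash (hd : IsModularRank d) {y u z : α} (h : RankSlash d y u z) :
    u ⊔ z ⊓ y = z := by
  obtain ⟨a, b, c⟩ := h
  have h1 := hd.sup_add_inf u (z ⊓ y)
  rw [← inf_assoc, inf_eq_left.2 a] at h1
  exact hd.eq_of_le (sup_le a inf_le_left) (by omega)

lemma not_rankZero_of_rankSlash (hd : IsModularRank d) {y u w z : α} (huz : u ≤ z)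
    (hw : RankSlash d y u w) : ¬ RankZero d y w z := by
  intro h
  obtain ⟨a, b, c, e⟩ := hd.rankZero_iff.1 h
  have h1 := hd.sup_inf_eq_of_rankSlash hw
  have h2 : w ≤ z := h1.ge.trans (sup_le huz (c.le.trans inf_le_left))
  rw [sup_eq_right.2 h2] at b
  omega

lemma setOf_rankZero_rankSlash_of_rankSlash (hd : IsModularRank d) {y u z : α}
    (h : RankSlash d y u z) :
    {v | RankZero d y u v ∧ RankSlash d y v z} =
      {v | v ⊓ (z ⊓ y) = u ⊓ y ∧ v ⊔ z ⊓ y = z} \ {u} := by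
  ext v
  constructor
  · rintro ⟨h0, hs⟩
    obtain ⟨a, b, c, e⟩ := hd.rankZero_iff.1 h0
    refine ⟨⟨?_, hd.sup_inf_eq_of_rankSlash hs⟩, ?_⟩
    · rw [← inf_assoc, inf_eq_left.2 hs.1, c]
    · rintro rfl
      rw [sup_idem] at b
      omega
  · rintro ⟨⟨a, b⟩, hne⟩
    have hm := hd.sup_add_inf v (z ⊓ y)
    obtain ⟨h1, h2, h3⟩ := h
    have hvz : v ≤ z := by rw [← b]; exact le_sup_left
    rw [a, b] at hm
    rw [← inf_assoc, inf_eq_left.2 hvz] at a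
    have hs : u ⊔ v = z := by
      refine hd.eq_of_le (sup_le h1 hvz) ?_
      have : u < u ⊔ v := by
        refine lt_of_le_of_ne le_sup_left fun h => hne ?_
        exact hd.eq_of_le (sup_eq_left.1 h.symm) (by omega)
      have := hd.strictMono this
      omega
    refine ⟨hd.rankZero_iff.2 ⟨by omega, by rw [hs]; omega, a.symm, by rw [hs]; omega⟩,
      hvz, by omega, by rw [a]; omega⟩

/-- The relative position of `u` and `z` for which paths `u, w, z` of type `L1 F0` exist when `u` is
not below `z`. -/
def SkewSlash (d : α → ℤ) (y u z : α) : Prop :=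
  d z = d u + 1 ∧ d (u ⊔ z) = d z + 1 ∧ u ⊓ y ≤ z ∧ d (z ⊓ y) = d (u ⊓ y) + 1 ∧
    d ((u ⊔ z) ⊓ y) = d (u ⊓ y) + 2

lemma skewSlash_of_rankSlash_rankZero (hd : IsModularRank d) {y u w z : α}
    (hw : RankSlash d y u w) (h0 : RankZero d y w z) :
    SkewSlash d y u z ∧ w = u ⊔ z ⊓ y := by
  obtain ⟨a, b, c, e⟩ := hd.rankZero_iff.1 h0
  have h1 := hd.sup_inf_eq_of_rankSlash hw
  rw [c] at h1
  have h2 : w ⊔ z = u ⊔ z := by rw [← h1, sup_assoc, sup_eq_right.2 (inf_le_left : z ⊓ y ≤ z)]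
  obtain ⟨f, g, h⟩ := hw
  rw [h2] at b e
  refine ⟨⟨by omega, by omega, (inf_le_inf_right y f).trans (c.le.trans inf_le_left), ?_, ?_⟩,
    h1.symm⟩
  · rw [← c]; omega
  · omega

lemma inf_eq_inf_of_rankZero_rankSlash (hd : IsModularRank d) {y u v z : α} (huz : ¬ u ≤ z)
    (h0 : RankZero d y u v) (hv : RankSlash d y v z) : u ⊓ v = u ⊓ z := by
  have hlt : u ⊓ z < u := lt_of_le_of_ne inf_le_left fun h => huz (inf_eq_left.1 h)
  have := hd.strictMono hlt
  have := h0.2.2.1.2.1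
  exact hd.eq_of_le (inf_le_inf_left u hv.1) (by omega)

lemma skewSlash_of_rankZero_rankSlash (hd : IsModularRank d) {y u v z : α} (huz : ¬ u ≤ z)
    (h0 : RankZero d y u v) (hv : RankSlash d y v z) : SkewSlash d y u z := by
  have h1 := hd.inf_eq_inf_of_rankZero_rankSlash huz h0 hv
  obtain ⟨a, b, c, e⟩ := hd.rankZero_iff.1 h0
  have h2 := hd.sup_inf_eq_of_rankSlash hv
  have m1 := hd.sup_add_inf u v
  have m2 := hd.sup_add_inf u z
  rw [h1] at m1
  obtain ⟨f, g, h⟩ := hv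
  refine ⟨by omega, by omega, c.le.trans (inf_le_left.trans f), by rw [c, h], ?_⟩
  have h3 := hd.inf_sub_le y (le_sup_right : z ≤ u ⊔ z)
  have h4 : z ⊓ y < (u ⊔ z) ⊓ y := by
    refine lt_of_le_of_ne (inf_le_inf_right y le_sup_right) fun heq => huz ?_
    have h5 : (u ⊔ v) ⊓ y = z ⊓ y :=
      hd.eq_of_le ((inf_le_inf_right y (sup_le_sup_left f u)).trans heq.ge) (by rw [h, e, c])
    have h6 : z ≤ u ⊔ v := h2.ge.trans (sup_le le_sup_right (h5.ge.trans inf_le_left))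
    have h7 := hd.eq_of_le h6 (by omega)
    rw [h7]
    exact le_sup_left
  have := hd.strictMono h4
  rw [c] at e ⊢
  omega

lemma rankSlash_rankZero_of_skewSlash (hd : IsModularRank d) {y u z : α}
    (h : SkewSlash d y u z) :
    RankSlash d y u (u ⊔ z ⊓ y) ∧ RankZero d y (u ⊔ z ⊓ y) z := by
  obtain ⟨a, b, c, e, f⟩ := h
  have h1 : u ⊓ (z ⊓ y) = u ⊓ y :=
    le_antisymm (inf_le_inf_left u inf_le_right) (le_inf inf_le_left (le_inf c inf_le_right))
  have m1 := hd.sup_add_inf u (z ⊓ y)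
  rw [h1] at m1
  have h2 := hd.inf_sub_le y (le_sup_left : u ≤ u ⊔ z ⊓ y)
  have h3 : z ⊓ y = (u ⊔ z ⊓ y) ⊓ y :=
    hd.eq_of_le (le_inf le_sup_right inf_le_right) (by omega)
  have h4 : u ⊔ z ⊓ y ⊔ z = u ⊔ z := by rw [sup_assoc, sup_eq_right.2 (inf_le_left : z ⊓ y ≤ z)]
  refine ⟨⟨le_sup_left, by omega, by rw [← h3, e]⟩, hd.rankZero_iff.2
    ⟨by omega, by rw [h4]; omega, h3.symm, by rw [h4, ← h3]; omega⟩⟩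

lemma setOf_rankZero_rankSlash_of_skewSlash [IsModularLattice α] (hd : IsModularRank d)
    {y u z : α} (h : SkewSlash d y u z) :
    {v | RankZero d y u v ∧ RankSlash d y v z} =
      {v | v ⊓ (u ⊓ z ⊔ z ⊓ y) = u ⊓ z ∧ v ⊔ (u ⊓ z ⊔ z ⊓ y) = z} := by
  have hc := h
  obtain ⟨a, b, c, e, f⟩ := h
  have huz : ¬ u ≤ z := fun h => by rw [sup_eq_right.2 h] at b; omega
  have m2 := hd.sup_add_inf u z
  have h1 : u ⊓ z ⊓ (z ⊓ y) = u ⊓ y :=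
    le_antisymm (le_inf (inf_le_left.trans inf_le_left) (inf_le_right.trans inf_le_right))
      (le_inf (le_inf inf_le_left c) (le_inf c inf_le_right))
  have m3 := hd.sup_add_inf (u ⊓ z) (z ⊓ y)
  rw [h1] at m3
  ext v
  constructor
  · rintro ⟨h0, hs⟩
    have h2 := hd.inf_eq_inf_of_rankZero_rankSlash huz h0 hs
    have h3 := hd.sup_inf_eq_of_rankSlash hs
    obtain ⟨-, -, g, -⟩ := hd.rankZero_iff.1 h0
    have h4 : u ⊓ z ≤ v := h2.ge.trans inf_le_right
    constructor
    · rw [inf_comm, sup_inf_assoc_of_le _ h4, sup_eq_left]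
      refine le_inf ?_ (inf_le_left.trans inf_le_left)
      refine le_trans (le_inf inf_le_right (inf_le_left.trans inf_le_right)) (g.ge.trans inf_le_left)
    · rw [← sup_assoc, sup_eq_left.2 h4, h3]
  · rintro ⟨g, i⟩
    have m4 := hd.sup_add_inf v (u ⊓ z ⊔ z ⊓ y)
    rw [g, i] at m4
    have hvz : v ≤ z := i.le.trans' le_sup_left
    have huzv : u ⊓ z ≤ v := g.ge.trans inf_le_left
    have h2 : u ⊓ y ≤ v ⊓ y := le_inf ((le_inf inf_le_left c).trans huzv) inf_le_right
    have h3 : v ⊓ y < z ⊓ y := by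
      refine lt_of_le_of_ne (inf_le_inf_right y hvz) fun heq => ?_
      have h4 : u ⊓ z ⊔ z ⊓ y ≤ v := sup_le huzv (heq.ge.trans inf_le_left)
      rw [sup_eq_left.2 h4] at i
      rw [i] at m4
      omega
    have h3' := hd.strictMono h3
    have h5 := hd.eq_of_le h2 (by omega)
    have h6 : u ⊓ v = u ⊓ z :=
      le_antisymm (inf_le_inf_left u hvz) (le_inf inf_le_left huzv)
    have m5 := hd.sup_add_inf u v
    rw [h6] at m5
    have h7 := hd.inf_sub_le y (le_sup_left : u ≤ u ⊔ v)
    have h8 := hd.inf_sub_le y (sup_le_sup_left hvz u)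
    exact ⟨hd.rankZero_iff.2 ⟨by omega, by omega, h5, by omega⟩, hvz, by omega, by rw [← h5, e]⟩

/-- The commutation relation between `F0` and `L1`, entrywise. -/
lemma ncard_rankZero_rankSlash [IsModularLattice α] [Finite α] (hd : IsModularRank d) {q : ℕ}
    (hq : HasComplementCount d q) (y u z : α) :
    ({v | RankZero d y u v ∧ RankSlash d y v z}.ncard : ℤ) =
      q * {w | RankSlash d y u w ∧ RankZero d y w z}.ncard +
        if RankSlash d y u z then (q : ℤ) ^ (d u - d (u ⊓ y)).toNat - 1 else 0 := by
  by_cases hs : RankSlash d y u z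
  · have e1 : {w | RankSlash d y u w ∧ RankZero d y w z} = ∅ :=
      Set.eq_empty_of_forall_notMem fun w hw => hd.not_rankZero_of_rankSlash hs.1 hw.1 hw.2
    have e2 : d z - d (u ⊓ y) - 1 = d u - d (u ⊓ y) := by have := hs.2.1; omega
    have hu : u ∈ {v | v ⊓ (z ⊓ y) = u ⊓ y ∧ v ⊔ z ⊓ y = z} :=
      ⟨by rw [← inf_assoc, inf_eq_left.2 hs.1], hd.sup_inf_eq_of_rankSlash hs⟩
    have e3 := Set.ncard_sdiff_singleton_add_one hu (Set.toFinite _)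
    rw [hq _ _ _ (inf_le_inf_right y hs.1) inf_le_left (Or.inl hs.2.2), e2] at e3
    rw [e1, hd.setOf_rankZero_rankSlash_of_rankSlash hs, if_pos hs]
    zify at e3
    simp only [Set.ncard_empty, Nat.cast_zero, mul_zero, zero_add]
    linarith
  · rw [if_neg hs, add_zero]
    by_cases hk : SkewSlash d y u z
    · have e1 : {w | RankSlash d y u w ∧ RankZero d y w z} = {u ⊔ z ⊓ y} := by
        ext w
        refine ⟨fun h => (hd.skewSlash_of_rankSlash_rankZero h.1 h.2).2, ?_⟩
        rintro rfl
        exact hd.rankSlash_rankZero_of_skewSlash hk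
      have m2 := hd.sup_add_inf u z
      rw [e1, hd.setOf_rankZero_rankSlash_of_skewSlash hk]
      obtain ⟨a, b, c, e, f⟩ := hk
      have h1 : u ⊓ z ⊓ (z ⊓ y) = u ⊓ y :=
        le_antisymm (le_inf (inf_le_left.trans inf_le_left) (inf_le_right.trans inf_le_right))
          (le_inf (le_inf inf_le_left c) (le_inf c inf_le_right))
      have m3 := hd.sup_add_inf (u ⊓ z) (z ⊓ y)
      rw [h1] at m3
      have e2 : d z - d (u ⊓ z) - 1 = 1 := by omega
      rw [hq _ _ _ le_sup_left (sup_le inf_le_right inf_le_left) (Or.inl (by omega)), e2]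
      simp
    · have e1 : {w | RankSlash d y u w ∧ RankZero d y w z} = ∅ :=
        Set.eq_empty_of_forall_notMem fun w hw =>
          hk (hd.skewSlash_of_rankSlash_rankZero hw.1 hw.2).1
      have e2 : {v | RankZero d y u v ∧ RankSlash d y v z} = ∅ := by
        refine Set.eq_empty_of_forall_notMem fun v hv => ?_
        by_cases huz : u ≤ z
        · obtain ⟨a, -, c, -⟩ := hd.rankZero_iff.1 hv.1
          exact hs ⟨huz, by rw [← a]; exact hv.2.2.1, by rw [c]; exact hv.2.2.2⟩
        · exact hk (hd.skewSlash_of_rankZero_rankSlash huz hv.1 hv.2)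
      simp [e1, e2]

/-- The rank function of the dual lattice. -/
lemma neg_dual (hd : IsModularRank d) :
    IsModularRank fun x : αᵒᵈ => - d (OrderDual.ofDual x) where
  strictMono a b h := neg_lt_neg (hd.strictMono (show OrderDual.ofDual b < OrderDual.ofDual a from h))
  sup_add_inf a b := by
    have := hd.sup_add_inf (OrderDual.ofDual a) (OrderDual.ofDual b)
    simp only [ofDual_sup, ofDual_inf]
    omega

lemma rankSlash_dual_iff (hd : IsModularRank d) {y u v : α} :
    RankSlash (fun x : αᵒᵈ => - d (OrderDual.ofDual x)) (OrderDual.toDual y) (OrderDual.toDual u)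
      (OrderDual.toDual v) ↔ RankBack d y v u := by
  have := hd.sup_add_inf u y
  have := hd.sup_add_inf v y
  simp only [RankSlash, RankBack, OrderDual.toDual_le_toDual, ofDual_inf, OrderDual.ofDual_toDual]
  refine and_congr_right fun _ => ?_
  omega

lemma rankBack_dual_iff (hd : IsModularRank d) {y u v : α} :
    RankBack (fun x : αᵒᵈ => - d (OrderDual.ofDual x)) (OrderDual.toDual y) (OrderDual.toDual u)
      (OrderDual.toDual v) ↔ RankSlash d y v u := by
  have := hd.sup_add_inf u y
  have := hd.sup_add_inf v y
  simp only [RankSlash, RankBack, OrderDual.toDual_le_toDual, ofDual_inf, OrderDual.ofDual_toDual]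
  refine and_congr_right fun _ => ?_
  omega

lemma rankZero_dual_iff (hd : IsModularRank d) {y u v : α} :
    RankZero (fun x : αᵒᵈ => - d (OrderDual.ofDual x)) (OrderDual.toDual y) (OrderDual.toDual u)
      (OrderDual.toDual v) ↔ RankZero d y u v := by
  simp only [RankZero, ← toDual_inf, ← toDual_sup, hd.rankSlash_dual_iff, hd.rankBack_dual_iff]
  tauto

end IsModularRank

lemma HasComplementCount.neg_dual {d : α → ℤ} {q : ℕ} (hq : HasComplementCount d q) :
    HasComplementCount (fun x : αᵒᵈ => - d (OrderDual.ofDual x)) q := by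
  intro m p t hmp hpt h
  have e : - d (OrderDual.ofDual t) - - d (OrderDual.ofDual m) - 1 =
      d (OrderDual.ofDual m) - d (OrderDual.ofDual t) - 1 := by ring
  rw [e, ← hq (OrderDual.ofDual t) (OrderDual.ofDual p) (OrderDual.ofDual m) hpt hmp
    (by dsimp only at h; omega)]
  congr 1
  ext v
  exact and_comm

namespace IsModularRank

variable {d : α → ℤ}

/-- The commutation relation between `F0` and `R2`, entrywise. -/
lemma ncard_rankZero_rankBack [IsModularLattice α] [Finite α] (hd : IsModularRank d) {q : ℕ}
    (hq : HasComplementCount d q) (y u z : α) :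
    ({v | RankZero d y u v ∧ RankBack d y z v}.ncard : ℤ) =
      q * {w | RankBack d y w u ∧ RankZero d y w z}.ncard +
        if RankBack d y z u then (q : ℤ) ^ (d y - d (u ⊓ y)).toNat - 1 else 0 := by
  have h := hd.neg_dual.ncard_rankZero_rankSlash hq.neg_dual (OrderDual.toDual y)
    (OrderDual.toDual u) (OrderDual.toDual z)
  have e : - d u - - d (u ⊔ y) = d y - d (u ⊓ y) := by
    have := hd.sup_add_inf u y
    omega
  simp only [ofDual_inf, OrderDual.ofDual_toDual, e, hd.rankSlash_dual_iff] at h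
  have e1 : {v | RankZero d y u v ∧ RankBack d y z v} =
      {v | RankZero (fun x : αᵒᵈ => - d (OrderDual.ofDual x)) (OrderDual.toDual y)
          (OrderDual.toDual u) v ∧
        RankSlash (fun x : αᵒᵈ => - d (OrderDual.ofDual x)) (OrderDual.toDual y) v
          (OrderDual.toDual z)} :=
    Set.ext fun _ => and_congr hd.rankZero_dual_iff.symm hd.rankSlash_dual_iff.symm
  have e2 : {w | RankBack d y w u ∧ RankZero d y w z} =
      {w | RankSlash (fun x : αᵒᵈ => - d (OrderDual.ofDual x)) (OrderDual.toDual y)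
          (OrderDual.toDual u) w ∧
        RankZero (fun x : αᵒᵈ => - d (OrderDual.ofDual x)) (OrderDual.toDual y) w
          (OrderDual.toDual z)} :=
    Set.ext fun _ => and_congr hd.rankSlash_dual_iff.symm hd.rankZero_dual_iff.symm
  rw [e1, e2]
  exact h

end IsModularRank

end RankedLattice
section ComplementCount

variable [Fintype F] [FiniteDimensional F V]

/-- The number of complements of a subspace of a finite vector space. -/
lemma ncard_isCompl (p : Submodule F V) :
    {c | IsCompl p c}.ncard =
      Fintype.card F ^ ((Module.finrank F V - Module.finrank F p) * Module.finrank F p) := by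
  obtain ⟨c, hc⟩ := p.exists_isCompl
  let f₀ := p.isComplEquivProj ⟨c, hc⟩
  let e : { f : V →ₗ[F] p // ∀ x : p, f x = x } ≃ { f : V →ₗ[F] p // p ≤ LinearMap.ker f } :=
    { toFun := fun f => ⟨f.1 - f₀.1, fun x hx => by
        have h1 := f.2 ⟨x, hx⟩
        have h2 := f₀.2 ⟨x, hx⟩
        simp only at h1 h2
        rw [LinearMap.mem_ker, LinearMap.sub_apply, h1, h2, sub_self]⟩
      invFun := fun f => ⟨f.1 + f₀.1, fun x => by
        rw [LinearMap.add_apply, LinearMap.mem_ker.1 (f.2 x.2), f₀.2 x, zero_add]⟩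
      left_inv := fun f => by simp
      right_inv := fun f => by simp }
  let e' : { f : V →ₗ[F] p // p ≤ LinearMap.ker f } ≃ (V ⧸ p →ₗ[F] p) :=
    { toFun := fun f => p.liftQ f.1 f.2
      invFun := fun g => ⟨g ∘ₗ p.mkQ, fun x hx => by simp [(Submodule.Quotient.mk_eq_zero p).2 hx]⟩
      left_inv := fun f => Subtype.ext (p.liftQ_mkQ f.1 f.2)
      right_inv := fun g => by ext; simp }
  have h1 : {c | IsCompl p c}.ncard = Nat.card (V ⧸ p →ₗ[F] p) :=
    Nat.card_congr ((p.isComplEquivProj.trans e).trans e')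
  rw [h1, Module.natCard_eq_pow_finrank (K := F), Module.finrank_linearMap,
    Submodule.finrank_quotient, Nat.card_eq_fintype_card]

/-- The number of relative complements in an interval of subspaces. -/
lemma ncard_inf_eq_and_sup_eq {m p t : Submodule F V} (hmp : m ≤ p) (hpt : p ≤ t) :
    {v | v ⊓ p = m ∧ v ⊔ p = t}.ncard =
      Fintype.card F ^ ((Module.finrank F t - Module.finrank F p) *
        (Module.finrank F p - Module.finrank F m)) := by
  let m' : Submodule F t := m.comap t.subtype
  let g : Submodule F (t ⧸ m') → Submodule F V := fun c => (c.comap m'.mkQ).map t.subtype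
  have hgi : Function.Injective g :=
    (Submodule.map_injective_of_injective t.injective_subtype).comp
      (Submodule.comap_injective_of_surjective m'.mkQ_surjective)
  have hg_inf (a b) : g (a ⊓ b) = g a ⊓ g b := by
    simp only [g, Submodule.comap_inf, Submodule.map_inf _ t.injective_subtype]
  have hg_sup (a b) : g (a ⊔ b) = g a ⊔ g b := by
    have : (a ⊔ b).comap m'.mkQ = a.comap m'.mkQ ⊔ b.comap m'.mkQ := by
      have h1 : m' ≤ a.comap m'.mkQ ⊔ b.comap m'.mkQ :=
        (m'.le_comap_mkQ a).trans le_sup_left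
      conv_lhs =>
        rw [← Submodule.map_comap_eq_of_surjective m'.mkQ_surjective a,
          ← Submodule.map_comap_eq_of_surjective m'.mkQ_surjective b]
      rw [← Submodule.map_sup, Submodule.comap_map_mkQ, sup_eq_right.2 h1]
    simp only [g, this, Submodule.map_sup]
  have hg_range {c : Submodule F V} (hmc : m ≤ c) (hct : c ≤ t) :
      g ((c.comap t.subtype).map m'.mkQ) = c := by
    have h1 : m' ≤ c.comap t.subtype := Submodule.comap_mono hmc
    simp only [g]
    rw [Submodule.comap_map_mkQ, sup_eq_right.2 h1, Submodule.map_comap_subtype, inf_eq_right.2 hct]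
  have hg_bot : g ⊥ = m := by
    simp only [g]
    rw [Submodule.comap_bot, Submodule.ker_mkQ, Submodule.map_comap_subtype,
      inf_eq_right.2 (hmp.trans hpt)]
  have hg_top : g ⊤ = t := by
    simp only [g]
    rw [Submodule.comap_top, Submodule.map_subtype_top]
  let p' : Submodule F (t ⧸ m') := (p.comap t.subtype).map m'.mkQ
  have hgp : g p' = p := hg_range hmp hpt
  have himg : {v | v ⊓ p = m ∧ v ⊔ p = t} = g '' {c | IsCompl p' c} := by
    ext v
    constructor
    · rintro ⟨h1, h2⟩
      have hv := hg_range (c := v) (h1.ge.trans inf_le_left) (h2.le.trans' le_sup_left)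
      refine ⟨_, ?_, hv⟩
      rw [← hv, ← hgp, inf_comm, ← hg_inf] at h1
      rw [← hv, ← hgp, sup_comm, ← hg_sup] at h2
      exact ⟨disjoint_iff.2 (hgi (h1.trans hg_bot.symm)),
        codisjoint_iff.2 (hgi (h2.trans hg_top.symm))⟩
    · rintro ⟨c, hc, rfl⟩
      rw [Set.mem_ofPred_eq, ← hgp, inf_comm, sup_comm, ← hg_inf, ← hg_sup, hc.inf_eq_bot, hc.sup_eq_top]
      exact ⟨hg_bot, hg_top⟩
  have hcomap {c : Submodule F V} (hct : c ≤ t) :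
      Module.finrank F (c.comap t.subtype) = Module.finrank F c := by
    rw [← Submodule.finrank_map_subtype_eq t, Submodule.map_comap_subtype, inf_eq_right.2 hct]
  have h1 := m'.finrank_quotient_add_finrank
  have h2 := p'.finrank_quotient_add_finrank
  have h3 := (p.comap t.subtype).finrank_quotient_add_finrank
  have h4 : Module.finrank F ((t ⧸ m') ⧸ p') = Module.finrank F (t ⧸ p.comap t.subtype) :=
    (Submodule.quotientQuotientEquivQuotient m' _ (Submodule.comap_mono hmp)).finrank_eq
  have h5 : Module.finrank F m' = Module.finrank F m := hcomap (hmp.trans hpt)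
  rw [hcomap hpt] at h3
  have h6 := Submodule.finrank_mono hmp
  have h7 := Submodule.finrank_mono hpt
  rw [himg, Set.ncard_image_of_injective _ hgi, ncard_isCompl]
  congr 2 <;> omega

end ComplementCount

section SubspaceMatrices

/-- The dimension of a subspace, as an integer. -/
def intFinrank (u : Submodule F V) : ℤ := Module.finrank F u

lemma slashCovers_iff (y u v : Submodule F V) :
    SlashCovers y u v ↔ RankSlash intFinrank y u v := by
  simp only [SlashCovers, Covers, RankSlash, intFinrank, and_assoc]
  norm_cast

lemma backslashCovers_iff (y u v : Submodule F V) :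
    BackslashCovers y u v ↔ RankBack intFinrank y u v := by
  simp only [BackslashCovers, Covers, RankBack, intFinrank, and_assoc]
  norm_cast

lemma matL1_apply (y u v : Submodule F V) :
    matL1 y u v = if RankSlash intFinrank y u v then 1 else 0 := by
  simp only [matL1, Matrix.of_apply, slashCovers_iff]

lemma matR2_apply (y u v : Submodule F V) :
    matR2 y u v = if RankBack intFinrank y v u then 1 else 0 := by
  simp only [matR2, matL2, Matrix.transpose_apply, Matrix.of_apply, backslashCovers_iff]

lemma matF0_apply (y u v : Submodule F V) :
    matF0 y u v = if RankZero intFinrank y u v then 1 else 0 := by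
  simp only [matF0, Matrix.of_apply, slashCovers_iff, backslashCovers_iff, RankZero]
  congr

lemma sum_ite_mul_ite {ι : Type*} [Fintype ι] (P Q : ι → Prop) :
    ∑ w, (if P w then (1 : ℂ) else 0) * (if Q w then 1 else 0) =
      (({w | P w ∧ Q w}.ncard : ℤ) : ℂ) := by
  rw [Set.ncard_eq_toFinset_card']
  simp [← ite_and, Finset.sum_boole, and_comm]

variable [FiniteDimensional F V]

lemma isModularRank_intFinrank : IsModularRank (intFinrank : Submodule F V → ℤ) where
  strictMono a b h := by
    have := Submodule.finrank_lt_finrank_of_lt h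
    simp only [intFinrank]
    omega
  sup_add_inf a b := by
    have := Submodule.finrank_sup_add_finrank_inf_eq a b
    simp only [intFinrank]
    omega

lemma hasComplementCount_intFinrank [Fintype F] :
    HasComplementCount (intFinrank : Submodule F V → ℤ) (Fintype.card F) := by
  intro m p t hmp hpt h
  rw [ncard_inf_eq_and_sup_eq hmp hpt]
  have h6 := Submodule.finrank_mono hmp
  have h7 := Submodule.finrank_mono hpt
  simp only [intFinrank] at h ⊢
  congr 1
  rcases h with h | h
  · rw [show Module.finrank F p - Module.finrank F m = 1 by omega]
    omega
  · rw [show Module.finrank F t - Module.finrank F p = 1 by omega]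
    omega

variable [Fintype (Submodule F V)]

lemma matR_eq_matR2_mul_matL1 (y : Submodule F V) : matR y = matR2 y * matL1 y := by
  ext u v
  simp only [matR, Matrix.mul_apply, matL1_apply, matR2_apply, sum_ite_mul_ite]
  rw [isModularRank_intFinrank.ncard_rankSlash_rankBack]

variable [Fintype F]

lemma matF0_mul_matL1 (y : Submodule F V) :
    matF0 y * matL1 y = (Fintype.card F : ℂ) • (matL1 y * matF0 y) +
      (Matrix.diagonal fun u : Submodule F V =>
        (Fintype.card F : ℂ) ^ (intFinrank u - intFinrank (u ⊓ y)).toNat - 1) * matL1 y := by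
  ext u v
  rw [Matrix.add_apply, Matrix.smul_apply, Matrix.diagonal_mul]
  simp only [Matrix.mul_apply, matL1_apply, matF0_apply, sum_ite_mul_ite]
  rw [isModularRank_intFinrank.ncard_rankZero_rankSlash hasComplementCount_intFinrank]
  push_cast
  simp

lemma matF0_mul_matR2 (y : Submodule F V) :
    matF0 y * matR2 y = (Fintype.card F : ℂ) • (matR2 y * matF0 y) +
      (Matrix.diagonal fun u : Submodule F V =>
        (Fintype.card F : ℂ) ^ (intFinrank y - intFinrank (u ⊓ y)).toNat - 1) * matR2 y := by
  ext u v
  rw [Matrix.add_apply, Matrix.smul_apply, Matrix.diagonal_mul]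
  simp only [Matrix.mul_apply, matR2_apply, matF0_apply, sum_ite_mul_ite]
  rw [isModularRank_intFinrank.ncard_rankZero_rankBack hasComplementCount_intFinrank]
  push_cast
  simp

lemma smul_matR2_mul_diagonal (y : Submodule F V) :
    (Fintype.card F : ℂ) • (matR2 y * Matrix.diagonal fun u : Submodule F V =>
        (Fintype.card F : ℂ) ^ (intFinrank u - intFinrank (u ⊓ y)).toNat) =
      (Matrix.diagonal fun u : Submodule F V =>
        (Fintype.card F : ℂ) ^ (intFinrank u - intFinrank (u ⊓ y)).toNat) * matR2 y := by
  ext u v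
  simp only [Matrix.smul_apply, Matrix.diagonal_mul, Matrix.mul_diagonal, matR2_apply]
  split_ifs with h
  · obtain ⟨-, h1, h2⟩ := h
    have h3 := isModularRank_intFinrank.strictMono.monotone (inf_le_left : v ⊓ y ≤ v)
    rw [show (intFinrank u - intFinrank (u ⊓ y)).toNat =
      (intFinrank v - intFinrank (v ⊓ y)).toNat + 1 by omega, pow_succ]
    simp [mul_comm]
  · simp

end SubspaceMatrices

lemma qpow_mul_qpow {q : ℕ} (hq : 0 < q) (a b : ℝ) : qpow q a * qpow q b = qpow q (a + b) := by
  rw [qpow, qpow, qpow, Real.rpow_add (by exact_mod_cast hq), Complex.ofReal_mul]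

lemma qpow_natCast (q m : ℕ) : qpow q m = (q : ℂ) ^ m := by
  rw [qpow, Real.rpow_natCast]
  push_cast
  rfl

theorem statement0
    (q n k : ℕ) (hq : IsPrimePow q) (hkn : k < n) (hk : 1 ≤ k)
    (F V : Type) [Field F] [Fintype F] (hcard : Fintype.card F = q)
    [AddCommGroup V] [Module F V] [FiniteDimensional F V]
    (hdim : Module.finrank F V = n)
    [Fintype (Submodule F V)]
    (y : Submodule F V) (hy : Module.finrank F ↥y = k) :
    (q : ℂ) ^ 2 • (matR y * matF0 y) - matF0 y * matR y +
      (qpow q ((k : ℝ) / 2) • matK1 q k y + qpow q (((n : ℝ) - (k : ℝ)) / 2) • matK2 q n k y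
        - ((q : ℂ) + 1) • (1 : Matrix (Submodule F V) (Submodule F V) ℂ)) * matR y = 0 := by
  subst hcard hdim hy
  have hq0 : 0 < Fintype.card F := Fintype.card_pos
  set J : Matrix (Submodule F V) (Submodule F V) ℂ := Matrix.diagonal fun u =>
    (Fintype.card F : ℂ) ^ (intFinrank u - intFinrank (u ⊓ y)).toNat with hJ
  set K : Matrix (Submodule F V) (Submodule F V) ℂ := Matrix.diagonal fun u =>
    (Fintype.card F : ℂ) ^ (intFinrank y - intFinrank (u ⊓ y)).toNat with hK
  have hK1 : qpow (Fintype.card F) ((Module.finrank F y : ℝ) / 2) •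
      matK1 (Fintype.card F) (Module.finrank F y) y = K := by
    rw [matK1, hK, ← Matrix.diagonal_smul]
    congr 1
    funext u
    have h := Submodule.finrank_mono (inf_le_right : u ⊓ y ≤ y)
    rw [Pi.smul_apply, smul_eq_mul, qpow_mul_qpow hq0, ← qpow_natCast]
    congr 1
    rw [show (intFinrank y - intFinrank (u ⊓ y)).toNat =
      Module.finrank F y - Module.finrank F (u ⊓ y : Submodule F V) by simp only [intFinrank]; omega,
      Nat.cast_sub h]
    ring
  have hK2 : qpow (Fintype.card F) (((Module.finrank F V : ℝ) - (Module.finrank F y : ℝ)) / 2) •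
      matK2 (Fintype.card F) (Module.finrank F V) (Module.finrank F y) y = J := by
    rw [matK2, hJ, ← Matrix.diagonal_smul]
    congr 1
    funext u
    have h := Submodule.finrank_mono (inf_le_left : u ⊓ y ≤ u)
    rw [Pi.smul_apply, smul_eq_mul, qpow_mul_qpow hq0, ← qpow_natCast]
    congr 1
    rw [show (intFinrank u - intFinrank (u ⊓ y)).toNat =
      Module.finrank F u - Module.finrank F (u ⊓ y : Submodule F V) by simp only [intFinrank]; omega,
      Nat.cast_sub h]
    ring
  have hA := matF0_mul_matL1 y
  have hB := matF0_mul_matR2 y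
  have hC := smul_matR2_mul_diagonal y
  rw [show (Matrix.diagonal fun u : Submodule F V => (Fintype.card F : ℂ) ^
    (intFinrank u - intFinrank (u ⊓ y)).toNat - 1) = J - 1 by
      rw [hJ, ← Matrix.diagonal_one, Matrix.diagonal_sub]] at hA
  rw [show (Matrix.diagonal fun u : Submodule F V => (Fintype.card F : ℂ) ^
    (intFinrank y - intFinrank (u ⊓ y)).toNat - 1) = K - 1 by
      rw [hK, ← Matrix.diagonal_one, Matrix.diagonal_sub]] at hB
  rw [← hJ] at hC
  rw [hK1, hK2, matR_eq_matR2_mul_matL1]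
  have hF : matF0 y * (matR2 y * matL1 y) =
      (Fintype.card F : ℂ) ^ 2 • (matR2 y * matL1 y * matF0 y) + J * matR2 y * matL1 y -
        (Fintype.card F : ℂ) • (matR2 y * matL1 y) + (K - 1) * matR2 y * matL1 y := by
    rw [← mul_assoc, hB, add_mul, Matrix.smul_mul, mul_assoc (matR2 y), hA, ← hC]
    simp only [mul_add, sub_mul, mul_sub, smul_add, smul_sub, Matrix.mul_smul, Matrix.smul_mul,
      one_mul, mul_assoc, smul_smul, sq]
    abel
  rw [hF]
  simp only [add_mul, sub_mul, add_smul, Matrix.smul_mul, one_mul, one_smul, mul_assoc]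
  abel
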